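/- arXiv:2303.08853 — 3 statements merged into one kernel-verified Lean document; each statement's English description precedes it below -/
import Mathlib

section
/- Let ν ≥ 0 be a real number and let (a_n) be a sequence of real numbers such that |a_n| ≤ C·Rⁿ for some constants C, R > 0 and all n. Define f(t) = ∑_{n=0}^∞ a_n f_{n,ν}(t) for t > 0 (the series converges for every t > 0). Then f is twice differentiable on (0,∞) and for every t > 0, (L_ν f)(t) = ∑_{n=0}^∞ a_{n+1} f_{n,ν}(t). In other words, applying L_ν corresponds to the left shift on the coefficient sequence (a_n). -/
open Real

/-- The monomial `f_{n,ν}(t) = (t/2)^(2n+ν) / (Γ(ν+n+1)·n!)`. -/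
noncomputable def besselMonomial (ν : ℝ) (n : ℕ) (t : ℝ) : ℝ :=
  (t / 2) ^ (2 * (n : ℝ) + ν) / (Real.Gamma (ν + n + 1) * n.factorial)

/-- The Bessel operator `L_ν f (t) = f''(t) + f'(t)/t − (ν²/t²) f(t)`. -/
noncomputable def besselOp (ν : ℝ) (f : ℝ → ℝ) (t : ℝ) : ℝ :=
  deriv (deriv f) t + deriv f t / t - (ν ^ 2 / t ^ 2) * f t

theorem Summable.mul_exponent_mul_rpow {b p : ℕ → ℝ} (hp : ∀ n, 0 ≤ p n)
    (hb : ∀ t : ℝ, 0 < t → Summable fun n => b n * t ^ p n) {t : ℝ} (ht : 0 < t) :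
    Summable fun n => b n * p n * t ^ p n := by
  refine Summable.of_norm_bounded (hb (exp 1 * t) (by positivity)).norm fun n => ?_
  have hpe : p n ≤ exp 1 ^ p n := by
    rw [exp_one_rpow]
    linarith [add_one_le_exp (p n)]
  rw [mul_rpow (exp_pos 1).le ht.le, mul_assoc, norm_mul, norm_mul (b n)]
  refine mul_le_mul_of_nonneg_left ?_ (norm_nonneg _)
  have htp : 0 ≤ t ^ p n := by positivity
  rw [norm_of_nonneg (mul_nonneg (hp n) htp), norm_of_nonneg (by positivity)]
  exact mul_le_mul_of_nonneg_right hpe htp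

/-- A generalized power series with nonnegative real exponents that converges on `(0,∞)` can be
differentiated term by term there. -/
theorem hasDerivAt_tsum_mul_rpow {b p : ℕ → ℝ} (hp : ∀ n, 0 ≤ p n)
    (hb : ∀ t : ℝ, 0 < t → Summable fun n => b n * t ^ p n) {t : ℝ} (ht : 0 < t) :
    HasDerivAt (fun u => ∑' n, b n * u ^ p n) ((∑' n, b n * p n * t ^ p n) / t) t := by
  have hmem : t ∈ Set.Ioo (t / 2) (2 * t) := ⟨by linarith, by linarith⟩
  rw [← tsum_div_const]
  refine hasDerivAt_tsum_of_isPreconnected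
    (g' := fun n y => b n * p n * y ^ p n / y)
    (u := fun n => ‖b n * p n * (2 * t) ^ p n‖ / (t / 2))
    ((Summable.mul_exponent_mul_rpow hp hb (by positivity)).norm.div_const _)
    isOpen_Ioo isPreconnected_Ioo (fun n y hy => ?_) (fun n y hy => ?_) hmem (hb t ht) hmem
  · have hy0 : 0 < y := by linarith [hy.1]
    convert! (hasDerivAt_rpow_const (p := p n) (Or.inl hy0.ne')).const_mul (b n) using 1
    rw [rpow_sub_one hy0.ne']
    ring
  · have hy0 : 0 < y := by linarith [hy.1]
    rw [norm_div, norm_mul, norm_mul _ ((2 * t) ^ p n), norm_of_nonneg hy0.le,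
      norm_of_nonneg (rpow_nonneg hy0.le _), norm_of_nonneg (rpow_nonneg (by positivity) _)]
    have := rpow_le_rpow hy0.le hy.2.le (hp n)
    have := hy.1.le
    gcongr

theorem Real.Gamma_add_natCast_succ_add_one {ν : ℝ} (hν : 0 ≤ ν) (n : ℕ) :
    Gamma (ν + (n + 1 : ℕ) + 1) = (ν + n + 1) * Gamma (ν + n + 1) := by
  rw [← Gamma_add_one (by positivity)]
  push_cast
  ring_nf

theorem Real.Gamma_add_one_le_Gamma_add_natCast_add_one {ν : ℝ} (hν : 0 ≤ ν) (n : ℕ) :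
    Gamma (ν + 1) ≤ Gamma (ν + n + 1) := by
  induction n with
  | zero => simp
  | succ n ih =>
    have hpos : 0 < ν + n + 1 := by positivity
    rw [Gamma_add_natCast_succ_add_one hν]
    have h1 : 1 ≤ ν + n + 1 := by linarith [n.cast_nonneg (α := ℝ)]
    exact ih.trans (le_mul_of_one_le_left (Gamma_pos_of_pos hpos).le h1)

theorem summable_mul_besselMonomial {ν : ℝ} (hν : 0 ≤ ν) {a : ℕ → ℝ} {C R : ℝ}
    (ha : ∀ n, |a n| ≤ C * R ^ n) {t : ℝ} (ht : 0 < t) :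
    Summable fun n => a n * besselMonomial ν n t := by
  have hG : 0 < Gamma (ν + 1) := Gamma_pos_of_pos (by positivity)
  refine Summable.of_norm_bounded
    ((summable_pow_div_factorial (R * (t / 2) ^ 2)).mul_left
      (C * (t / 2) ^ ν / Gamma (ν + 1))) fun n => ?_
  have hGn := Gamma_add_one_le_Gamma_add_natCast_add_one hν n
  have hpow : (t / 2) ^ (2 * (n : ℝ) + ν) = ((t / 2) ^ 2) ^ n * (t / 2) ^ ν := by
    rw [rpow_add (by positivity), ← pow_mul, ← rpow_natCast]
    push_cast
    rfl
  have hnonneg : 0 ≤ besselMonomial ν n t := by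
    have := hG.trans_le hGn
    unfold besselMonomial
    positivity
  calc ‖a n * besselMonomial ν n t‖ = |a n| * besselMonomial ν n t := by
        rw [norm_mul, norm_of_nonneg hnonneg, norm_eq_abs]
    _ ≤ C * R ^ n * besselMonomial ν n t := mul_le_mul_of_nonneg_right (ha n) hnonneg
    _ ≤ C * R ^ n *
          (((t / 2) ^ 2) ^ n * (t / 2) ^ ν / (Gamma (ν + 1) * n.factorial)) := by
        refine mul_le_mul_of_nonneg_left ?_ ((abs_nonneg _).trans (ha n))
        rw [besselMonomial, hpow]
        gcongr
    _ = _ := by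
        rw [mul_pow]
        field_simp

theorem besselMonomial_eq_mul_rpow (ν : ℝ) (n : ℕ) {t : ℝ} (ht : 0 < t) :
    besselMonomial ν n t = besselMonomial ν n 1 * t ^ (2 * (n : ℝ) + ν) := by
  rw [besselMonomial, besselMonomial, div_eq_mul_one_div t 2,
    mul_rpow ht.le (by norm_num)]
  ring

/-- The action of `t² L_ν` on monomials, written through the eigenvalues of `t d/dt`. -/
theorem besselMonomial_succ_mul_sq_sub_sq {ν : ℝ} (hν : 0 ≤ ν) (n : ℕ) {t : ℝ} (ht : 0 < t) :
    ((2 * ((n + 1 : ℕ) : ℝ) + ν) ^ 2 - ν ^ 2) * besselMonomial ν (n + 1) t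
      = t ^ 2 * besselMonomial ν n t := by
  have hpos : 0 < ν + n + 1 := by positivity
  have hG := Gamma_pos_of_pos hpos
  have hpow : (t / 2) ^ (2 * ((n + 1 : ℕ) : ℝ) + ν)
      = (t / 2) ^ (2 * (n : ℝ) + ν) * (t / 2) ^ 2 := by
    rw [← rpow_natCast (t / 2) 2, ← rpow_add (by positivity)]
    push_cast
    ring_nf
  rw [besselMonomial, besselMonomial, Gamma_add_natCast_succ_add_one hν, hpow, Nat.factorial_succ]
  push_cast
  field_simp
  ring

/-- For geometrically bounded coefficients `(aₙ)`, the series `f(t) = ∑ aₙ f_{n,ν}(t)`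
converges for every `t > 0`, `f` is twice differentiable on `(0,∞)`, and applying `L_ν`
corresponds to the left shift on the coefficient sequence. -/
theorem besselOp_tsum_eq_leftShift (ν : ℝ) (hν : 0 ≤ ν) (a : ℕ → ℝ) (C R : ℝ)
    (hC : 0 < C) (hR : 0 < R) (ha : ∀ n, |a n| ≤ C * R ^ n) :
    (∀ t : ℝ, 0 < t → Summable fun n => a n * besselMonomial ν n t) ∧
    (∀ t : ℝ, 0 < t →
      DifferentiableAt ℝ (fun u => ∑' n, a n * besselMonomial ν n u) t ∧
      DifferentiableAt ℝ (deriv fun u => ∑' n, a n * besselMonomial ν n u) t) ∧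
    (∀ t : ℝ, 0 < t →
      besselOp ν (fun u => ∑' n, a n * besselMonomial ν n u) t
        = ∑' n, a (n + 1) * besselMonomial ν n t) := by
  have hsum : ∀ t : ℝ, 0 < t → Summable fun n => a n * besselMonomial ν n t :=
    fun t ht => summable_mul_besselMonomial hν ha ht
  set f : ℝ → ℝ := fun u => ∑' n, a n * besselMonomial ν n u
  let p : ℕ → ℝ := fun n => 2 * (n : ℝ) + ν
  let b : ℕ → ℝ := fun n => a n * besselMonomial ν n 1
  have hp : ∀ n, 0 ≤ p n := fun n => by positivity
  have hterm : ∀ n, ∀ t : ℝ, 0 < t → a n * besselMonomial ν n t = b n * t ^ p n :=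
    fun n t ht => by rw [besselMonomial_eq_mul_rpow ν n ht, ← mul_assoc]
  have hb : ∀ t : ℝ, 0 < t → Summable fun n => b n * t ^ p n :=
    fun t ht => (hsum t ht).congr fun n => hterm n t ht
  have hbp : ∀ t : ℝ, 0 < t → Summable fun n => b n * p n * t ^ p n :=
    fun t ht => Summable.mul_exponent_mul_rpow hp hb ht
  have hbpp : ∀ t : ℝ, 0 < t → Summable fun n => b n * p n * p n * t ^ p n :=
    fun t ht => Summable.mul_exponent_mul_rpow hp hbp ht
  have hf_eq : ∀ t : ℝ, 0 < t → f t = ∑' n, b n * t ^ p n :=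
    fun t ht => tsum_congr fun n => hterm n t ht
  have hd1 : ∀ t : ℝ, 0 < t → HasDerivAt f ((∑' n, b n * p n * t ^ p n) / t) t :=
    fun t ht => (hasDerivAt_tsum_mul_rpow hp hb ht).congr_of_eventuallyEq
      ((eventually_gt_nhds ht).mono hf_eq)
  have hd2 : ∀ t : ℝ, 0 < t → HasDerivAt (deriv f)
      (((∑' n, b n * p n * p n * t ^ p n) / t * t - (∑' n, b n * p n * t ^ p n) * 1) / t ^ 2) t :=
    fun t ht => ((hasDerivAt_tsum_mul_rpow hp hbp ht).div (hasDerivAt_id t) ht.ne')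
      |>.congr_of_eventuallyEq ((eventually_gt_nhds ht).mono fun u hu => (hd1 u hu).deriv)
  refine ⟨hsum, fun t ht => ⟨(hd1 t ht).differentiableAt, (hd2 t ht).differentiableAt⟩,
    fun t ht => ?_⟩
  have hshift : (∑' n, b n * p n * p n * t ^ p n) - ν ^ 2 * ∑' n, b n * t ^ p n
      = t ^ 2 * ∑' n, a (n + 1) * besselMonomial ν n t := by
    have hs := (hbpp t ht).sub ((hb t ht).mul_left (ν ^ 2))
    rw [← tsum_mul_left, ← (hbpp t ht).tsum_sub ((hb t ht).mul_left _),
      hs.tsum_eq_zero_add, ← tsum_mul_left]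
    have hzero : b 0 * p 0 * p 0 * t ^ p 0 - ν ^ 2 * (b 0 * t ^ p 0) = 0 := by
      have hp0 : p 0 = ν := by simp [p]
      rw [hp0]
      ring
    rw [hzero, zero_add]
    refine tsum_congr fun n => ?_
    calc b (n + 1) * p (n + 1) * p (n + 1) * t ^ p (n + 1) - ν ^ 2 * (b (n + 1) * t ^ p (n + 1))
        = (p (n + 1) ^ 2 - ν ^ 2) * (b (n + 1) * t ^ p (n + 1)) := by ring
      _ = a (n + 1) * ((p (n + 1) ^ 2 - ν ^ 2) * besselMonomial ν (n + 1) t) := by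
        rw [← hterm (n + 1) t ht]
        ring
      _ = t ^ 2 * (a (n + 1) * besselMonomial ν n t) := by
        rw [besselMonomial_succ_mul_sq_sub_sq hν n ht]
        ring
  rw [besselOp, (hd2 t ht).deriv, (hd1 t ht).deriv, hf_eq t ht]
  rw [← mul_right_inj' (pow_ne_zero 2 ht.ne'), ← hshift]
  field_simp
  ring
end

section
/- Let (a_n) be a sequence of real numbers with |a_n| ≤ C·Rⁿ for some constants C, R > 0 and all n, and define f(t) = ∑_{n=0}^∞ a_n t^(2n) / (4ⁿ (n!)²) for t > 0. Then for every natural number m, the m-fold iterate of the operator L_0 applied to f satisfies lim_{t→0⁺} (L_0^m f)(t) = a_m. (Thus the finite Bessel transform 𝒯_{B_0}[f] = {a_0, a_1, a_2, …} is recovered from f by iterating L_0 and taking limits at 0.) -/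
open Real

/-- The Bessel operator of order 0: `L₀ f (t) = f''(t) + f'(t)/t`. -/
noncomputable def besselOp0 (f : ℝ → ℝ) (t : ℝ) : ℝ :=
  deriv (deriv f) t + deriv f t / t

/-- If `∑ cₙ xⁿ` converges absolutely everywhere, so does its termwise derivative. -/
lemma summable_abs_succ_mul_pow {c : ℕ → ℝ} (hc : ∀ r : ℝ, Summable fun n => |c n| * r ^ n)
    (r : ℝ) : Summable fun n : ℕ => |(n + 1) * c (n + 1)| * r ^ n := by
  have hs := (summable_nat_add_iff 1).2 (hc (2 * (|r| + 1)))
  refine Summable.of_norm_bounded hs fun n => ?_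
  have hn : ((n : ℝ) + 1) ≤ 2 ^ (n + 1) := by exact_mod_cast (Nat.lt_two_pow_self (n := n + 1)).le
  have hr : |r| ^ n ≤ (|r| + 1) ^ (n + 1) :=
    calc |r| ^ n ≤ (|r| + 1) ^ n := by gcongr; linarith
      _ ≤ (|r| + 1) ^ (n + 1) :=
        pow_le_pow_right₀ (by linarith [abs_nonneg r]) (Nat.le_succ n)
  have hpos : |(n : ℝ) + 1| = n + 1 := abs_of_nonneg (by positivity)
  rw [norm_mul, norm_pow, Real.norm_eq_abs, Real.norm_eq_abs, abs_abs, abs_mul, hpos, mul_pow]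
  calc ((n : ℝ) + 1) * |c (n + 1)| * |r| ^ n
      = |c (n + 1)| * (((n : ℝ) + 1) * |r| ^ n) := by ring
    _ ≤ |c (n + 1)| * (2 ^ (n + 1) * (|r| + 1) ^ (n + 1)) := by gcongr

lemma summable_mul_pow_of_abs {c : ℕ → ℝ} (hc : ∀ r : ℝ, Summable fun n => |c n| * r ^ n)
    (x : ℝ) : Summable fun n => c n * x ^ n :=
  Summable.of_norm_bounded (hc |x|) fun n => by
    rw [norm_mul, norm_pow, Real.norm_eq_abs, Real.norm_eq_abs]

/-- Termwise differentiation of an everywhere absolutely convergent power series. -/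
lemma hasDerivAt_tsum_mul_pow {c : ℕ → ℝ} (hc : ∀ r : ℝ, Summable fun n => |c n| * r ^ n)
    (x : ℝ) : HasDerivAt (fun y => ∑' n, c n * y ^ n)
      (∑' n : ℕ, (n + 1) * c (n + 1) * x ^ n) x := by
  have hu : Summable fun n : ℕ => |c n| * (n * (|x| + 1) ^ (n - 1)) := by
    refine (summable_nat_add_iff 1).1 ((summable_abs_succ_mul_pow hc (|x| + 1)).congr fun n => ?_)
    rw [abs_mul, abs_of_nonneg (by positivity : (0 : ℝ) ≤ n + 1)]
    push_cast [Nat.add_sub_cancel]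
    ring
  have hx : x ∈ Metric.ball (0 : ℝ) (|x| + 1) := by simp
  have hbound : ∀ (n : ℕ) (y : ℝ), y ∈ Metric.ball (0 : ℝ) (|x| + 1) →
      ‖c n * (n * y ^ (n - 1))‖ ≤ |c n| * (n * (|x| + 1) ^ (n - 1)) := by
    intro n y hy
    rw [mem_ball_zero_iff, Real.norm_eq_abs] at hy
    rw [norm_mul, norm_mul, norm_pow, Real.norm_eq_abs, Real.norm_eq_abs, Real.norm_eq_abs,
      Nat.abs_cast]
    gcongr
  have h := hasDerivAt_tsum_of_isPreconnected hu Metric.isOpen_ball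
    (convex_ball (0 : ℝ) (|x| + 1)).isPreconnected
    (fun n y _ => (hasDerivAt_pow n y).const_mul (c n)) hbound hx
    (summable_mul_pow_of_abs hc x) hx
  refine h.congr_deriv ?_
  rw [(Summable.of_norm_bounded hu fun n => hbound n x hx).tsum_eq_zero_add]
  simp only [Nat.cast_zero, zero_mul, mul_zero, zero_add, Nat.add_sub_cancel]
  refine tsum_congr fun n => ?_
  push_cast
  ring

/-- `L₀` on an even power series multiplies the coefficients by `4 (n + 1)²` and shifts them. -/
lemma besselOp0_tsum_mul_sq_pow {c : ℕ → ℝ} (hc : ∀ r : ℝ, Summable fun n => |c n| * r ^ n)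
    {t : ℝ} (ht : t ≠ 0) :
    besselOp0 (fun s => ∑' n, c n * (s ^ 2) ^ n) t =
      ∑' n : ℕ, 4 * (n + 1) ^ 2 * c (n + 1) * (t ^ 2) ^ n := by
  have hc₁ := summable_abs_succ_mul_pow hc
  have hsq (s : ℝ) : HasDerivAt (fun s : ℝ => s ^ 2) (2 * s) s := by
    simpa using hasDerivAt_pow 2 s
  have hd (s : ℝ) := (hasDerivAt_tsum_mul_pow hc (s ^ 2)).comp s (hsq s)
  have hderiv : deriv (fun s => ∑' n, c n * (s ^ 2) ^ n) =
      fun s => (∑' n : ℕ, (n + 1) * c (n + 1) * (s ^ 2) ^ n) * (2 * s) :=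
    funext fun s => (hd s).deriv
  have hdd := ((hasDerivAt_tsum_mul_pow (c := fun n => (n + 1) * c (n + 1)) hc₁ (t ^ 2)).comp t
    (hsq t)).mul ((hasDerivAt_id t).const_mul 2)
  have hderiv₂ := hdd.deriv
  have h₁ := summable_mul_pow_of_abs hc₁ (t ^ 2)
  have h₂ := summable_mul_pow_of_abs
    (summable_abs_succ_mul_pow (c := fun n => (n + 1) * c (n + 1)) hc₁) (t ^ 2)
  have hshift : Summable fun n : ℕ => (n : ℝ) * ((n + 1) * c (n + 1)) * (t ^ 2) ^ n := by
    refine (summable_nat_add_iff 1).1 ((h₂.mul_left (t ^ 2)).congr fun n => ?_)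
    push_cast
    ring
  have hx : t ^ 2 * ∑' n : ℕ, ((n : ℝ) + 1) * (((n + 1 : ℕ) + 1 : ℝ) * c (n + 1 + 1)) * (t ^ 2) ^ n
      = ∑' n : ℕ, (n : ℝ) * ((n + 1) * c (n + 1)) * (t ^ 2) ^ n := by
    rw [hshift.tsum_eq_zero_add, ← tsum_mul_left]
    simp only [Nat.cast_zero, zero_mul, zero_add]
    refine tsum_congr fun n => ?_
    push_cast
    ring
  have hsum : ∑' n : ℕ, 4 * ((n : ℝ) + 1) ^ 2 * c (n + 1) * (t ^ 2) ^ n =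
      4 * ∑' n : ℕ, ((n : ℝ) + 1) * c (n + 1) * (t ^ 2) ^ n +
      4 * ∑' n : ℕ, (n : ℝ) * ((n + 1) * c (n + 1)) * (t ^ 2) ^ n := by
    rw [← tsum_mul_left, ← tsum_mul_left, ← (h₁.mul_left 4).tsum_add (hshift.mul_left 4)]
    exact tsum_congr fun n => by ring
  rw [hsum, ← hx, besselOp0, hderiv]
  refine (congrArg (· + _) hderiv₂).trans ?_
  simp only [Function.comp_apply, id]
  field_simp
  ring

lemma besselOp0_congr {f g : ℝ → ℝ} {t : ℝ} (h : f =ᶠ[nhds t] g) :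
    besselOp0 f t = besselOp0 g t := by
  rw [besselOp0, besselOp0, h.deriv.deriv_eq, h.deriv_eq]

lemma summable_abs_div_four_pow_mul_factorial_sq {a : ℕ → ℝ} {C R : ℝ}
    (ha : ∀ n, |a n| ≤ C * R ^ n) (r : ℝ) :
    Summable fun n : ℕ => |a n / (4 ^ n * (n.factorial : ℝ) ^ 2)| * r ^ n := by
  refine Summable.of_norm_bounded
    ((Real.summable_pow_div_factorial (R * |r|)).mul_left C) fun n => ?_
  have hfac : (1 : ℝ) ≤ n.factorial := by exact_mod_cast n.factorial_pos
  have hden : (n.factorial : ℝ) ≤ 4 ^ n * (n.factorial : ℝ) ^ 2 := by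
    have h4 : (1 : ℝ) ≤ 4 ^ n := one_le_pow₀ (by norm_num)
    nlinarith
  rw [norm_mul, norm_pow, Real.norm_eq_abs, Real.norm_eq_abs, abs_abs, abs_div,
    abs_of_nonneg (by positivity : (0 : ℝ) ≤ 4 ^ n * (n.factorial : ℝ) ^ 2)]
  calc |a n| / (4 ^ n * (n.factorial : ℝ) ^ 2) * |r| ^ n
      ≤ |a n| / n.factorial * |r| ^ n := by gcongr
    _ ≤ C * R ^ n / n.factorial * |r| ^ n := by gcongr; exact ha n
    _ = C * ((R * |r|) ^ n / n.factorial) := by rw [mul_pow]; ring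

/-- Away from `0`, iterating `L₀` shifts the coefficient sequence. -/
lemma iterate_besselOp0_tsum {a : ℕ → ℝ} {C R : ℝ} (ha : ∀ n, |a n| ≤ C * R ^ n) (m : ℕ)
    {t : ℝ} (ht : t ≠ 0) :
    besselOp0^[m] (fun s => ∑' n : ℕ, a n / (4 ^ n * (n.factorial : ℝ) ^ 2) * (s ^ 2) ^ n) t =
      ∑' n : ℕ, a (n + m) / (4 ^ n * (n.factorial : ℝ) ^ 2) * (t ^ 2) ^ n := by
  induction m generalizing t with
  | zero => rfl
  | succ m ih =>
    have ham (n : ℕ) : |a (n + m)| ≤ (C * R ^ m) * R ^ n :=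
      (ha (n + m)).trans_eq (by rw [pow_add]; ring)
    rw [Function.iterate_succ_apply',
      besselOp0_congr ((eventually_ne_nhds ht).mono fun s hs => ih hs),
      besselOp0_tsum_mul_sq_pow
        (summable_abs_div_four_pow_mul_factorial_sq (a := fun n => a (n + m)) ham) ht]
    refine tsum_congr fun n => ?_
    rw [Nat.factorial_succ, pow_succ 4 n, add_right_comm n 1 m, ← add_assoc]
    push_cast
    field_simp

/-- For geometrically bounded coefficients `(aₙ)` and
`f(t) = ∑ aₙ t^(2n)/(4ⁿ (n!)²)`, the finite Bessel transform coefficient `aₘ` is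
recovered as `lim_{t→0⁺} (L₀^m f)(t)`. -/
theorem besselTransform_coeff_recovered (a : ℕ → ℝ) (C R : ℝ)
    (hC : 0 < C) (hR : 0 < R) (ha : ∀ n, |a n| ≤ C * R ^ n) (m : ℕ) :
    Filter.Tendsto
      (besselOp0^[m] (fun t : ℝ => ∑' n : ℕ, a n * t ^ (2 * n) / (4 ^ n * (n.factorial : ℝ) ^ 2)))
      (nhdsWithin 0 (Set.Ioi 0)) (nhds (a m)) := by
  have hf : (fun t : ℝ => ∑' n : ℕ, a n * t ^ (2 * n) / (4 ^ n * (n.factorial : ℝ) ^ 2)) =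
      fun t => ∑' n : ℕ, a n / (4 ^ n * (n.factorial : ℝ) ^ 2) * (t ^ 2) ^ n :=
    funext fun t => tsum_congr fun n => by rw [pow_mul]; ring
  have ham (n : ℕ) : |a (n + m)| ≤ (C * R ^ m) * R ^ n :=
    (ha (n + m)).trans_eq (by rw [pow_add]; ring)
  have hcont : Continuous fun x : ℝ =>
      ∑' n : ℕ, a (n + m) / (4 ^ n * (n.factorial : ℝ) ^ 2) * x ^ n :=
    continuous_iff_continuousAt.2 fun x => (hasDerivAt_tsum_mul_pow
      (summable_abs_div_four_pow_mul_factorial_sq (a := fun n => a (n + m)) ham) x).continuousAt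
  have hzero : ∑' n : ℕ, a (n + m) / (4 ^ n * (n.factorial : ℝ) ^ 2) * ((0 : ℝ) ^ 2) ^ n = a m := by
    rw [tsum_eq_single 0 fun n hn => by simp [hn]]
    simp
  have hlim := (hcont.comp (continuous_pow 2)).tendsto 0
  simp only [Function.comp_apply, hzero] at hlim
  rw [hf]
  refine (hlim.mono_left nhdsWithin_le_nhds).congr' ?_
  filter_upwards [self_mem_nhdsWithin] with t ht
  exact (iterate_besselOp0_tsum ha m (ne_of_gt ht)).symm
end

section
/- Let μ > 0 and λ > 0 be real numbers, set κ = √(8/μ + λ²), and let c₁, c₂ be arbitrary real constants. Then the function y(t) = c₁·J₂(λt) + c₂·I₂(κt) satisfies the fourth-order Bessel-type equation (L₂(L₂ y))(t) − (8/μ)·(L₂ y)(t) − (λ² + 8/μ)·λ²·y(t) = 0 for all t > 0. -/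
open Real

/-- The Bessel function of the first kind of order 2:
`J₂(t) = ∑ (−1)ⁿ (t/2)^(2n+2) / (Γ(n+3)·n!)`. -/
noncomputable def besselJ2 (t : ℝ) : ℝ :=
  ∑' n : ℕ, (-1 : ℝ) ^ n * (t / 2) ^ (2 * n + 2) / (Real.Gamma (n + 3) * n.factorial)

/-- The modified Bessel function of the first kind of order 2:
`I₂(t) = ∑ (t/2)^(2n+2) / (Γ(n+3)·n!)`. -/
noncomputable def besselI2 (t : ℝ) : ℝ :=
  ∑' n : ℕ, (t / 2) ^ (2 * n + 2) / (Real.Gamma (n + 3) * n.factorial)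

/-- The Bessel operator `L₂ f (t) = f''(t) + f'(t)/t − (4/t²) f(t)`. -/
noncomputable def besselOp2 (f : ℝ → ℝ) (t : ℝ) : ℝ :=
  deriv (deriv f) t + deriv f t / t - (4 / t ^ 2) * f t

/-- The entire function `∑ xⁿ / (n! (n + k)!)`, through which the Bessel functions of
integer order `k` factor. -/
noncomputable def besselSeries (k : ℕ) (x : ℝ) : ℝ :=
  ∑' n : ℕ, x ^ n / (n.factorial * (n + k).factorial)

theorem summable_besselSeries (k : ℕ) (x : ℝ) :
    Summable fun n : ℕ => x ^ n / ((n.factorial : ℝ) * (n + k).factorial) := by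
  refine Summable.of_norm_bounded (Real.summable_pow_div_factorial |x|) fun n => ?_
  have h1 : (1 : ℝ) ≤ (n + k).factorial := by exact_mod_cast Nat.factorial_pos _
  have h0 : (0 : ℝ) < n.factorial := by exact_mod_cast Nat.factorial_pos _
  rw [Real.norm_eq_abs, abs_div, abs_pow,
    abs_of_pos (by positivity : (0 : ℝ) < n.factorial * (n + k).factorial)]
  exact div_le_div_of_nonneg_left (by positivity) h0 (le_mul_of_one_le_right h0.le h1)

theorem succ_mul_pow_div_factorial (k n : ℕ) (x : ℝ) :
    ((n + 1 : ℕ) : ℝ) * x ^ (n + 1 - 1) / ((n + 1).factorial * (n + 1 + k).factorial) =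
      x ^ n / (n.factorial * (n + (k + 1)).factorial) := by
  have h0 : (n.factorial : ℝ) ≠ 0 := by exact_mod_cast Nat.factorial_ne_zero _
  have h1 : ((n + (k + 1)).factorial : ℝ) ≠ 0 := by exact_mod_cast Nat.factorial_ne_zero _
  rw [show n + 1 + k = n + (k + 1) by ring, Nat.factorial_succ n, Nat.add_sub_cancel]
  push_cast
  field_simp

theorem summable_deriv_besselSeries (k : ℕ) (x : ℝ) :
    Summable fun n : ℕ => (n : ℝ) * x ^ (n - 1) / (n.factorial * (n + k).factorial) := by
  rw [← summable_nat_add_iff 1]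
  simp_rw [succ_mul_pow_div_factorial]
  exact summable_besselSeries (k + 1) x

theorem hasDerivAt_besselSeries (k : ℕ) (x : ℝ) :
    HasDerivAt (besselSeries k) (besselSeries (k + 1) x) x := by
  have hx : x ∈ Metric.ball (0 : ℝ) (|x| + 1) := by simp
  have h := hasDerivAt_tsum_of_isPreconnected
    (g := fun (n : ℕ) (y : ℝ) => y ^ n / ((n.factorial : ℝ) * (n + k).factorial))
    (g' := fun (n : ℕ) (y : ℝ) =>
      (n : ℝ) * y ^ (n - 1) / ((n.factorial : ℝ) * (n + k).factorial))
    (summable_deriv_besselSeries k (|x| + 1)) Metric.isOpen_ball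
    (convex_ball (0 : ℝ) (|x| + 1)).isPreconnected
    (fun n y _ => (hasDerivAt_pow n y).div_const _)
    (fun n y hy => by
      have hy' : |y| ≤ |x| + 1 := by simpa using (mem_ball_zero_iff.mp hy).le
      rw [Real.norm_eq_abs, abs_div, abs_mul, abs_pow, Nat.abs_cast,
        abs_of_nonneg (by positivity : (0 : ℝ) ≤ n.factorial * (n + k).factorial)]
      gcongr) hx (summable_besselSeries k x) hx
  rw [(summable_deriv_besselSeries k x).tsum_eq_zero_add] at h
  simp_rw [succ_mul_pow_div_factorial] at h
  simp only [Nat.cast_zero, zero_mul, zero_div, zero_add] at h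
  exact h

theorem besselSeries_recurrence (k : ℕ) (x : ℝ) :
    x * besselSeries (k + 2) x + (k + 1) * besselSeries (k + 1) x = besselSeries k x := by
  have hk : (k.factorial : ℝ) ≠ 0 := by exact_mod_cast Nat.factorial_ne_zero _
  unfold besselSeries
  rw [(summable_besselSeries (k + 1) x).tsum_eq_zero_add,
    (summable_besselSeries k x).tsum_eq_zero_add, mul_add, ← tsum_mul_left, ← tsum_mul_left,
    add_left_comm, ← Summable.tsum_add ((summable_besselSeries (k + 2) x).mul_left x)
      (((summable_nat_add_iff 1).mpr (summable_besselSeries (k + 1) x)).mul_left _)]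
  congr 1
  · simp only [zero_add, pow_zero, Nat.factorial_succ k, Nat.factorial_zero]
    push_cast
    field_simp
  · refine tsum_congr fun n => ?_
    have h0 : (n.factorial : ℝ) ≠ 0 := by exact_mod_cast Nat.factorial_ne_zero _
    have h1 : ((n + 1 + k).factorial : ℝ) ≠ 0 := by exact_mod_cast Nat.factorial_ne_zero _
    rw [show n + (k + 2) = n + 1 + k + 1 by ring, show n + 1 + (k + 1) = n + 1 + k + 1 by ring,
      Nat.factorial_succ (n + 1 + k), Nat.factorial_succ n]
    push_cast
    field_simp
    ring

theorem Gamma_natCast_add_three (n : ℕ) : Real.Gamma (n + 3) = (n + 2).factorial := by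
  rw [← Real.Gamma_nat_eq_factorial]
  push_cast
  ring_nf

theorem besselJ2_mul (a u : ℝ) :
    besselJ2 (a * u) = a ^ 2 / 4 * (u ^ 2 * besselSeries 2 (-(a ^ 2 / 4) * u ^ 2)) := by
  unfold besselJ2 besselSeries
  rw [← tsum_mul_left, ← tsum_mul_left]
  refine tsum_congr fun n => ?_
  rw [Gamma_natCast_add_three, pow_add, pow_mul,
    show -(a ^ 2 / 4) * u ^ 2 = -1 * (a * u / 2) ^ 2 by ring, mul_pow (-1)]
  ring

theorem besselI2_mul (a u : ℝ) :
    besselI2 (a * u) = a ^ 2 / 4 * (u ^ 2 * besselSeries 2 (a ^ 2 / 4 * u ^ 2)) := by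
  unfold besselI2 besselSeries
  rw [← tsum_mul_left, ← tsum_mul_left]
  refine tsum_congr fun n => ?_
  rw [Gamma_natCast_add_three, pow_add, pow_mul,
    show a ^ 2 / 4 * u ^ 2 = (a * u / 2) ^ 2 by ring]
  ring

theorem hasDerivAt_besselSeries_mul_sq (k : ℕ) (c u : ℝ) :
    HasDerivAt (fun v => besselSeries k (c * v ^ 2))
      (besselSeries (k + 1) (c * u ^ 2) * (c * (2 * u))) u := by
  refine ((hasDerivAt_besselSeries k (c * u ^ 2)).comp u
    ((hasDerivAt_pow 2 u).const_mul c)).congr_deriv ?_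
  simp

theorem hasDerivAt_sq_mul_besselSeries (c u : ℝ) :
    HasDerivAt (fun v => v ^ 2 * besselSeries 2 (c * v ^ 2))
      (2 * u * besselSeries 2 (c * u ^ 2) + 2 * c * u ^ 3 * besselSeries 3 (c * u ^ 2)) u := by
  refine ((hasDerivAt_pow 2 u).mul (hasDerivAt_besselSeries_mul_sq 2 c u)).congr_deriv ?_
  norm_num
  ring

theorem hasDerivAt_deriv_sq_mul_besselSeries (c u : ℝ) :
    HasDerivAt
      (fun v => 2 * v * besselSeries 2 (c * v ^ 2) + 2 * c * v ^ 3 * besselSeries 3 (c * v ^ 2))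
      (2 * besselSeries 2 (c * u ^ 2) + 10 * c * u ^ 2 * besselSeries 3 (c * u ^ 2)
        + 4 * c ^ 2 * u ^ 4 * besselSeries 4 (c * u ^ 2)) u := by
  refine ((((hasDerivAt_id' u).const_mul 2).mul (hasDerivAt_besselSeries_mul_sq 2 c u)).add
    (((hasDerivAt_pow 3 u).const_mul (2 * c)).mul
      (hasDerivAt_besselSeries_mul_sq 3 c u))).congr_deriv ?_
  norm_num
  ring

/-- `u² ∑ (c u²)ⁿ / (n! (n + 2)!)` is an eigenfunction of `L₂` with eigenvalue `4c`; stated for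
linear combinations of two such functions. -/
theorem besselOp2_linear_combination (a b c d : ℝ) {u : ℝ} (hu : u ≠ 0) :
    besselOp2 (fun v => a * (v ^ 2 * besselSeries 2 (c * v ^ 2))
        + b * (v ^ 2 * besselSeries 2 (d * v ^ 2))) u =
      4 * c * a * (u ^ 2 * besselSeries 2 (c * u ^ 2))
        + 4 * d * b * (u ^ 2 * besselSeries 2 (d * u ^ 2)) := by
  have h1 := funext fun v => (((hasDerivAt_sq_mul_besselSeries c v).const_mul a).add
    ((hasDerivAt_sq_mul_besselSeries d v).const_mul b)).deriv
  have h2 := (((hasDerivAt_deriv_sq_mul_besselSeries c u).const_mul a).add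
    ((hasDerivAt_deriv_sq_mul_besselSeries d u).const_mul b)).deriv
  have hc := besselSeries_recurrence 2 (c * u ^ 2)
  have hd := besselSeries_recurrence 2 (d * u ^ 2)
  norm_num at hc hd
  simp only [Pi.add_def] at h1 h2
  unfold besselOp2
  rw [h1, h2]
  beta_reduce
  rw [← hc, ← hd]
  field_simp
  ring

theorem besselOp2_congr {f g : ℝ → ℝ} {t : ℝ} (h : f =ᶠ[nhds t] g) :
    besselOp2 f t = besselOp2 g t := by
  unfold besselOp2
  rw [h.deriv.deriv_eq, h.deriv_eq, h.eq_of_nhds]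

/-- `y(t) = c₁ J₂(λt) + c₂ I₂(κt)` with `κ = √(8/μ + λ²)` solves the fourth-order
Bessel-type equation `L₂(L₂ y) − (8/μ) L₂ y − (λ² + 8/μ)λ² y = 0` on `(0,∞)`. -/
theorem fourth_order_bessel_solution (μ lam : ℝ) (hμ : 0 < μ) (hlam : 0 < lam)
    (c₁ c₂ : ℝ) (t : ℝ) (ht : 0 < t) :
    besselOp2 (besselOp2 fun u => c₁ * besselJ2 (lam * u)
        + c₂ * besselI2 (Real.sqrt (8 / μ + lam ^ 2) * u)) t
      - (8 / μ) * besselOp2 (fun u => c₁ * besselJ2 (lam * u)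
        + c₂ * besselI2 (Real.sqrt (8 / μ + lam ^ 2) * u)) t
      - (lam ^ 2 + 8 / μ) * lam ^ 2 * (c₁ * besselJ2 (lam * t)
        + c₂ * besselI2 (Real.sqrt (8 / μ + lam ^ 2) * t)) = 0 := by
  have hκ : Real.sqrt (8 / μ + lam ^ 2) ^ 2 = 8 / μ + lam ^ 2 := Real.sq_sqrt (by positivity)
  simp only [besselJ2_mul, besselI2_mul, hκ, ← mul_assoc c₁, ← mul_assoc c₂]
  rw [besselOp2_congr (Filter.eventually_of_mem (isOpen_ne.mem_nhds ht.ne')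
      fun u hu => besselOp2_linear_combination _ _ _ _ hu),
    besselOp2_linear_combination _ _ _ _ ht.ne', besselOp2_linear_combination _ _ _ _ ht.ne']
  ring
end
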